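/- arXiv:1205.1173 — 2 statements merged into one kernel-verified Lean document; each statement's English description precedes it below -/
import Mathlib

section
/- (Conditional Subset Typicality Lemma, Lemma 2.) Suppose for each i ∈ {1,…,N} there is a set A_i ⊆ {1,…,i−1} such that {i} ∪ A_i ⊆ 𝒮_j for some j ∈ {1,…,M}. Generate random sequences X_1^n,…,X_N^n sequentially: the l-th coordinate of X_i^n is drawn from the conditional distribution P(X_i = · | X_k = x_{k,l} for k ∈ A_i) derived from the prescribed distribution P_{𝒮_j} on a subset 𝒮_j containing {i} ∪ A_i, independently across l = 1,…,n, and conditionally independent of all previously generated sequences given (X_k^n)_{k∈A_i}. Let P* be a PMF on ∏_{i=1}^N 𝒳_i attaining H*({1,…,N}). Then there exists δ : (0,∞) → (0,∞) with δ(ε) → 0 as ε → 0 such that for every sufficiently small ε > 0 and all sufficiently large n: 2^{−n(∑_{i=1}^N H(X_i | {X}_{A_i}) − H(P*) + δ(ε))} ≤ Prob( for every j, the tuple (X_i^n)_{i∈𝒮_j} is jointly ε-typical for P_{𝒮_j} ) ≤ 2^{−n(∑_{i=1}^N H(X_i | {X}_{A_i}) − H(P*) − δ(ε))}, where H(X_i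 | {X}_{A_i}) is the conditional Shannon entropy computed under the prescribed distribution on a subset 𝒮_j containing {i} ∪ A_i. -/
open scoped Classical

noncomputable section

/-- A probability mass function on a finite type: nonnegative and summing to one. -/
def IsPMF {α : Type*} [Fintype α] (p : α → ℝ) : Prop :=
  (∀ x, 0 ≤ p x) ∧ ∑ x, p x = 1

/-- Shannon entropy in bits, with the convention `0 · log₂ 0 = 0`. -/
def Ent {α : Type*} [Fintype α] (p : α → ℝ) : ℝ :=
  -∑ x, p x * Real.logb 2 (p x)

/-- Pushforward of a mass function along a map. -/
def push {α β : Type*} [Fintype α] (f : α → β) (p : α → ℝ) : β → ℝ :=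
  fun b => ∑ a ∈ Finset.univ.filter (fun a => f a = b), p a

/-- Tuples indexed by a finite subset `A` of the coordinates. -/
abbrev Vec {N : ℕ} (X : Fin N → Type) (A : Finset (Fin N)) : Type :=
  ∀ i : {i // i ∈ A}, X i.1

section

variable {N : ℕ} {X : Fin N → Type} [∀ i, Fintype (X i)]

/-- Restriction of a tuple on coordinates `A` to a smaller subset `B ⊆ A`. -/
def restr {A B : Finset (Fin N)} (h : B ⊆ A) (x : Vec X A) : Vec X B :=
  fun i => x ⟨i.1, h i.2⟩

/-- Marginal of a mass function on coordinates `A` onto `B ⊆ A`. -/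
def marg {A B : Finset (Fin N)} (p : Vec X A → ℝ) (h : B ⊆ A) : Vec X B → ℝ :=
  push (restr h) p

/-- Marginal of a mass function on all coordinates onto the subset `A`. -/
def margF (p : (∀ i, X i) → ℝ) (A : Finset (Fin N)) : Vec X A → ℝ :=
  push (fun x i => x i.1) p

/-- Single-coordinate marginal. -/
def margOne (p : (∀ i, X i) → ℝ) (i : Fin N) : X i → ℝ :=
  push (fun x => x i) p

variable {M : ℕ}

/-- The prescribed subset distributions are PMFs, consistent with each other
(marginals agree on intersections) and with the single-coordinate marginals `P i`. -/
def Consistent (P : ∀ i, X i → ℝ) (S : Fin M → Finset (Fin N))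
    (PS : ∀ j, Vec X (S j) → ℝ) : Prop :=
  (∀ i, IsPMF (P i)) ∧ (∀ j, IsPMF (PS j)) ∧
  (∀ j j', marg (PS j) (Finset.inter_subset_left : S j ∩ S j' ⊆ S j)
         = marg (PS j') (Finset.inter_subset_right : S j ∩ S j' ⊆ S j')) ∧
  (∀ j, ∀ i, ∀ h : i ∈ S j, push (fun x : Vec X (S j) => x ⟨i, h⟩) (PS j) = P i)

/-- The constrained maximum entropy `H*(𝒥)`: the supremum of entropies of PMFs on
`∏_{i ∈ 𝒥} 𝒳_i` whose marginal on `𝒥 ∩ 𝒮_j` equals the marginal of `P_{𝒮_j}` for every `j`. -/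
def Hstar (S : Fin M → Finset (Fin N)) (PS : ∀ j, Vec X (S j) → ℝ)
    (J : Finset (Fin N)) : ℝ :=
  sSup { h | ∃ q : Vec X J → ℝ, IsPMF q ∧
    (∀ j, marg q (Finset.inter_subset_left : J ∩ S j ⊆ J)
        = marg (PS j) (Finset.inter_subset_right : J ∩ S j ⊆ S j)) ∧
    h = Ent q }

end

/-- `ε`-typicality of a length-`n` sequence for a PMF `Q`. -/
def Typical {α : Type*} [Fintype α] (n : ℕ) (ε : ℝ) (Q : α → ℝ) (x : Fin n → α) : Prop :=
  ∀ a, |((Finset.univ.filter (fun l => x l = a)).card : ℝ) / n - Q a| ≤ ε * Q a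

/-- Joint `ε`-typicality, for the tuple of sequences restricted to the subset `A`,
of the induced sequence over the product alphabet. -/
def SubTyp {N : ℕ} {X : Fin N → Type} [∀ i, Fintype (X i)] (n : ℕ) (ε : ℝ)
    {A : Finset (Fin N)} (Q : Vec X A → ℝ) (x : ∀ i, Fin n → X i) : Prop :=
  Typical n ε Q (fun l (i : {i // i ∈ A}) => x i.1 l)

/-- Probability of the event `E` when the `N` sequences of length `n` are generated
mutually independently, coordinatewise i.i.d. according to the marginals `P i`. -/
def probIID {N : ℕ} {X : Fin N → Type} [∀ i, Fintype (X i)] (P : ∀ i, X i → ℝ) (n : ℕ)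
    (E : (∀ i, Fin n → X i) → Prop) : ℝ :=
  ∑ x ∈ Finset.univ.filter E, ∏ i, ∏ l, P i (x i l)

/-- `δ` is a valid correction function: positive on positive arguments and
vanishing as `ε → 0⁺`. -/
def DeltaFun (δ : ℝ → ℝ) : Prop :=
  (∀ ε, 0 < ε → 0 < δ ε) ∧ Filter.Tendsto δ (nhdsWithin 0 (Set.Ioi 0)) (nhds 0)

end
/-- The probability mass of generating the tuple of sequences `x` sequentially, where the
`l`-th coordinate of the `i`-th sequence is drawn from the conditional distribution of
coordinate `i` given the coordinates in `A i`, derived from the prescribed distribution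
`PS (jsel i)` on a subset containing `{i} ∪ A i`. -/
noncomputable def condMass {N M : ℕ} {X : Fin N → Type} [∀ i, Fintype (X i)]
    (S : Fin M → Finset (Fin N)) (PS : ∀ j, Vec X (S j) → ℝ)
    (A : Fin N → Finset (Fin N)) (jsel : Fin N → Fin M)
    (hjsel : ∀ i, insert i (A i) ⊆ S (jsel i)) (n : ℕ) (x : ∀ i, Fin n → X i) : ℝ :=
  ∏ i, ∏ l,
    marg (PS (jsel i)) (hjsel i) (fun k => x k.1 l) /
      marg (PS (jsel i)) ((Finset.subset_insert i (A i)).trans (hjsel i)) (fun k => x k.1 l)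

section Pushforward

variable {α β γ : Type*} [Fintype α]

lemma sum_push_mul [Fintype β] (f : α → β) (p : α → ℝ) (g : β → ℝ) :
    ∑ b, push f p b * g b = ∑ a, p a * g (f a) := by
  rw [← Finset.sum_fiberwise Finset.univ f (fun a => p a * g (f a))]
  refine Finset.sum_congr rfl fun b _ => ?_
  rw [push, Finset.sum_mul]
  refine Finset.sum_congr rfl fun a ha => ?_
  rw [(Finset.mem_filter.1 ha).2]

lemma sum_push [Fintype β] (f : α → β) (p : α → ℝ) : ∑ b, push f p b = ∑ a, p a := by
  simpa using sum_push_mul f p (fun _ => 1)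

lemma push_push [Fintype β] (f : α → β) (g : β → γ) (p : α → ℝ) :
    push g (push f p) = push (fun a => g (f a)) p := by
  funext c
  have h := sum_push_mul f p (fun b => if g b = c then 1 else 0)
  simpa [push, Finset.sum_filter] using h

lemma le_push {f : α → β} {p : α → ℝ} (hp : ∀ a, 0 ≤ p a) (a : α) : p a ≤ push f p (f a) :=
  Finset.single_le_sum (f := p) (fun a _ => hp a) (by simp)

lemma IsPMF.push [Fintype β] {p : α → ℝ} (hp : IsPMF p) (f : α → β) : IsPMF (push f p) :=
  ⟨fun _ => Finset.sum_nonneg fun a _ => hp.1 a, by rw [sum_push, hp.2]⟩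

lemma ent_push_equiv [Fintype β] (e : α ≃ β) (p : α → ℝ) : Ent (push e p) = Ent p := by
  have h : ∀ a, push e p (e a) = p a := fun a => by
    simp [_root_.push, Finset.sum_filter]
  rw [Ent, Ent, ← e.sum_comp]
  simp only [h]

lemma continuous_push (f : α → β) (b : β) : Continuous fun p : α → ℝ => push f p b :=
  continuous_finsetSum _ fun a _ => continuous_apply a

end Pushforward

section Entropy

variable {α : Type*} [Fintype α]

lemma continuous_ent : Continuous (Ent : (α → ℝ) → ℝ) := by
  unfold Ent Real.logb
  refine (continuous_finsetSum _ fun a _ => ?_).neg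
  have h := (Real.continuous_mul_log.comp (continuous_apply (A := fun _ : α => ℝ) a)).div_const
    (Real.log 2)
  refine h.congr fun p => ?_
  simp [mul_div_assoc]

lemma isCompact_setOf_isPMF : IsCompact {p : α → ℝ | IsPMF p} :=
  isCompact_stdSimplex ℝ α

lemma bddAbove_ent : BddAbove (Ent '' {p : α → ℝ | IsPMF p}) :=
  isCompact_setOf_isPMF.bddAbove_image continuous_ent.continuousOn

end Entropy

section Empirical

/-- The empirical distribution of a finite sequence. -/
noncomputable def empirical {α : Type*} {n : ℕ} (y : Fin n → α) (a : α) : ℝ :=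
  ((Finset.univ.filter (fun l => y l = a)).card : ℝ) / n

variable {α β : Type*} [Fintype α] {n : ℕ}

lemma mul_sum_empirical_mul (hn : 0 < n) (y : Fin n → α) (g : α → ℝ) :
    (n : ℝ) * ∑ a, empirical y a * g a = ∑ l, g (y l) := by
  have hn' : (n : ℝ) ≠ 0 := by positivity
  rw [Finset.mul_sum, ← Finset.sum_fiberwise Finset.univ y (fun l => g (y l))]
  refine Finset.sum_congr rfl fun a _ => ?_
  rw [Finset.sum_congr rfl (g := fun _ => g a)
    (fun l hl => by rw [(Finset.mem_filter.1 hl).2])]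
  rw [Finset.sum_const, nsmul_eq_mul, empirical]
  field_simp

lemma isPMF_empirical (hn : 0 < n) (y : Fin n → α) : IsPMF (empirical y) := by
  have hn' : (n : ℝ) ≠ 0 := by positivity
  refine ⟨fun a => by unfold empirical; positivity, ?_⟩
  have h := mul_sum_empirical_mul hn y (fun _ => 1)
  simp only [mul_one, Finset.sum_const, Finset.card_univ, Fintype.card_fin, nsmul_eq_mul] at h
  exact mul_left_cancel₀ hn' (by rw [h, mul_one])

lemma empirical_apply_pos {α : Type*} (hn : 0 < n) (y : Fin n → α) (l : Fin n) :
    0 < empirical y (y l) := by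
  have : 0 < (Finset.univ.filter (fun k => y k = y l)).card :=
    Finset.card_pos.2 ⟨l, by simp⟩
  unfold empirical
  positivity

lemma push_empirical (f : α → β) (y : Fin n → α) :
    push f (empirical y) = empirical (fun l => f (y l)) := by
  funext b
  unfold push empirical
  rw [← Finset.sum_div, ← Nat.cast_sum]
  congr 2
  rw [Finset.card_eq_sum_card_fiberwise (f := y) (t := Finset.univ.filter (fun a => f a = b))
    (fun l hl => by simpa using hl)]
  refine Finset.sum_congr rfl fun a ha => ?_
  congr 1
  ext l
  simp only [Finset.mem_filter, Finset.mem_univ, true_and] at ha ⊢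
  constructor
  · rintro rfl
    exact ⟨ha, rfl⟩
  · exact fun h => h.2

lemma Typical.apply_pos {ε : ℝ} {Q : α → ℝ} (hQ : ∀ a, 0 ≤ Q a) {y : Fin n → α}
    (hn : 0 < n) (hy : Typical n ε Q y) (l : Fin n) : 0 < Q (y l) := by
  refine lt_of_le_of_ne (hQ _) fun h => ?_
  have h1 : |empirical y (y l) - Q (y l)| ≤ ε * Q (y l) := hy (y l)
  have h2 := empirical_apply_pos hn y l
  rw [← h, mul_zero, sub_zero, abs_of_pos h2] at h1
  linarith

lemma Typical.abs_sum_sub_le {ε : ℝ} {Q : α → ℝ} {y : Fin n → α} (hy : Typical n ε Q y)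
    (g : α → ℝ) :
    |∑ a, empirical y a * g a - ∑ a, Q a * g a| ≤ ε * ∑ a, Q a * |g a| := by
  rw [← Finset.sum_sub_distrib, Finset.mul_sum]
  refine (Finset.abs_sum_le_sum_abs _ _).trans (Finset.sum_le_sum fun a _ => ?_)
  rw [← sub_mul, abs_mul, ← mul_assoc]
  exact mul_le_mul_of_nonneg_right (hy a) (abs_nonneg _)

lemma Typical.push [Fintype β] {ε : ℝ} {Q : α → ℝ} {y : Fin n → α} (hy : Typical n ε Q y)
    (f : α → β) : Typical n ε (push f Q) (fun l => f (y l)) := by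
  intro b
  change |empirical (fun l => f (y l)) b - _| ≤ _
  rw [← push_empirical]
  unfold _root_.push
  rw [← Finset.sum_sub_distrib, Finset.mul_sum]
  exact (Finset.abs_sum_le_sum_abs _ _).trans (Finset.sum_le_sum fun a _ => hy a)

lemma prod_eq_two_rpow (hn : 0 < n) (y : Fin n → α) (W G : α → ℝ)
    (h : ∀ l, W (y l) = 2 ^ G (y l)) :
    ∏ l, W (y l) = (2 : ℝ) ^ ((n : ℝ) * ∑ a, empirical y a * G a) := by
  rw [mul_sum_empirical_mul hn, Real.rpow_sum_of_pos two_pos]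
  exact Finset.prod_congr rfl fun l _ => h l

end Empirical

section TypeCounting

variable {α : Type*} [Fintype α] {n : ℕ}

lemma sum_prod_eq_one {p : α → ℝ} (hp : IsPMF p) (n : ℕ) :
    ∑ y : Fin n → α, ∏ l, p (y l) = 1 := by
  rw [← Fintype.sum_pow, hp.2, one_pow]

lemma card_empirical_eq_le (hn : 0 < n) (π : α → ℝ) :
    ((Finset.univ.filter (fun y : Fin n → α => empirical y = π)).card : ℝ)
      ≤ 2 ^ ((n : ℝ) * Ent π) := by
  rcases (Finset.univ.filter (fun y : Fin n → α => empirical y = π)).eq_empty_or_nonempty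
    with h | ⟨y₀, hy₀⟩
  · rw [h, Finset.card_empty, Nat.cast_zero]
    positivity
  have hπ : IsPMF π := (Finset.mem_filter.1 hy₀).2 ▸ isPMF_empirical hn y₀
  have hmass : ∀ y ∈ Finset.univ.filter (fun y : Fin n → α => empirical y = π),
      ∏ l, π (y l) = (2 : ℝ) ^ (-((n : ℝ) * Ent π)) := by
    intro y hy
    obtain rfl := (Finset.mem_filter.1 hy).2
    rw [prod_eq_two_rpow hn y _ (fun a => Real.logb 2 (empirical y a)) fun l =>
      (Real.rpow_logb two_pos (by norm_num) (empirical_apply_pos hn y l)).symm]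
    simp [Ent]
  have hle := Finset.sum_le_sum_of_subset_of_nonneg
    (Finset.filter_subset (fun y : Fin n → α => empirical y = π) Finset.univ)
    (f := fun y => ∏ l, π (y l))
    (fun y _ _ => Finset.prod_nonneg fun l _ => hπ.1 (y l))
  rw [Finset.sum_congr rfl hmass, sum_prod_eq_one hπ, Finset.sum_const, nsmul_eq_mul,
    Real.rpow_neg two_pos.le, mul_inv_le_iff₀ (by positivity), one_mul] at hle
  exact hle

lemma card_image_empirical_le (B : Finset (Fin n → α)) :
    (B.image empirical).card ≤ (n + 1) ^ Fintype.card α := by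
  have hsub : B.image empirical ⊆
      (Finset.univ : Finset (α → Fin (n + 1))).image (fun c a => ((c a : ℕ) : ℝ) / n) := by
    intro π hπ
    obtain ⟨y, -, rfl⟩ := Finset.mem_image.1 hπ
    refine Finset.mem_image.2 ⟨fun a => ⟨(Finset.univ.filter (fun l => y l = a)).card, ?_⟩,
      Finset.mem_univ _, rfl⟩
    exact Nat.lt_succ_of_le ((Finset.card_le_univ _).trans_eq (Fintype.card_fin n))
  refine (Finset.card_le_card hsub).trans (Finset.card_image_le.trans_eq ?_)
  simp

lemma card_le_of_ent_empirical_le (hn : 0 < n) (B : Finset (Fin n → α)) {h : ℝ}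
    (hB : ∀ y ∈ B, Ent (empirical y) ≤ h) :
    (B.card : ℝ) ≤ ((n : ℝ) + 1) ^ Fintype.card α * 2 ^ ((n : ℝ) * h) := by
  have hcard : (B.card : ℝ) = ∑ π ∈ B.image empirical,
      ((B.filter (fun y => empirical y = π)).card : ℝ) := by
    exact_mod_cast Finset.card_eq_sum_card_image empirical B
  have hfib : ∀ π ∈ B.image empirical,
      ((B.filter (fun y => empirical y = π)).card : ℝ) ≤ 2 ^ ((n : ℝ) * h) := by
    intro π hπ
    obtain ⟨y, hy, rfl⟩ := Finset.mem_image.1 hπ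
    have h1 : ((B.filter (fun z => empirical z = empirical y)).card : ℝ) ≤
        ((Finset.univ.filter (fun z : Fin n → α => empirical z = empirical y)).card : ℝ) := by
      exact_mod_cast Finset.card_le_card (Finset.filter_subset_filter _ (Finset.subset_univ B))
    refine (h1.trans (card_empirical_eq_le hn _)).trans ?_
    exact Real.rpow_le_rpow_of_exponent_le one_le_two
      (mul_le_mul_of_nonneg_left (hB y hy) n.cast_nonneg)
  rw [hcard]
  refine (Finset.sum_le_sum hfib).trans ?_
  rw [Finset.sum_const, nsmul_eq_mul]
  refine mul_le_mul_of_nonneg_right ?_ (by positivity)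
  exact_mod_cast card_image_empirical_le B

lemma exists_forall_pow_le_two_rpow (k : ℕ) {ε : ℝ} (hε : 0 < ε) :
    ∃ n₀ : ℕ, ∀ n ≥ n₀, ((n : ℝ) + 1) ^ k ≤ 2 ^ ((n : ℝ) * ε) := by
  have hr : 1 < (2 : ℝ) ^ ε := Real.one_lt_rpow one_lt_two hε
  have ht := (tendsto_pow_const_div_const_pow_of_one_lt k hr).comp
    (Filter.tendsto_add_atTop_nat 1)
  have hpos : 0 < ((2 : ℝ) ^ ε)⁻¹ := by positivity
  obtain ⟨n₀, hn₀⟩ := Filter.eventually_atTop.1 (ht.eventually_le_const hpos)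
  refine ⟨n₀, fun n hn => ?_⟩
  have h := hn₀ n hn
  simp only [Function.comp_apply] at h
  rw [div_le_iff₀ (by positivity), pow_succ, mul_comm _ ((2 : ℝ) ^ ε),
    inv_mul_cancel_left₀ (zero_lt_one.trans hr).ne'] at h
  rw [mul_comm (n : ℝ), Real.rpow_mul two_pos.le, Real.rpow_natCast]
  exact_mod_cast h

end TypeCounting

section LawOfLargeNumbers

variable {α : Type*} [Fintype α]

lemma sum_fin_succ_arrow {n : ℕ} (F : (Fin (n + 1) → α) → ℝ) :
    ∑ y, F y = ∑ a, ∑ y : Fin n → α, F (Fin.cons a y) := by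
  rw [← (Fin.consEquiv (fun _ : Fin (n + 1) => α)).sum_comp, Fintype.sum_prod_type]
  rfl

lemma sum_prod_mul_sum_eq_zero {p f : α → ℝ} (hp : IsPMF p) (hf : ∑ a, p a * f a = 0) (n : ℕ) :
    ∑ y : Fin n → α, (∏ l, p (y l)) * ∑ l, f (y l) = 0 := by
  induction n with
  | zero => simp
  | succ n ih =>
    rw [sum_fin_succ_arrow]
    simp only [Fin.prod_univ_succ, Fin.sum_univ_succ, Fin.cons_zero, Fin.cons_succ]
    have h : ∀ a, ∑ y : Fin n → α, (p a * ∏ l, p (y l)) * (f a + ∑ l, f (y l))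
        = p a * f a := fun a => by
      calc _ = p a * f a * ∑ y : Fin n → α, ∏ l, p (y l)
            + p a * ∑ y : Fin n → α, (∏ l, p (y l)) * ∑ l, f (y l) := by
            rw [Finset.mul_sum, Finset.mul_sum, ← Finset.sum_add_distrib]
            exact Finset.sum_congr rfl fun y _ => by ring
        _ = _ := by rw [ih, sum_prod_eq_one hp]; ring
    simp only [h, hf]

lemma sum_prod_mul_sum_sq {p f : α → ℝ} (hp : IsPMF p) (hf : ∑ a, p a * f a = 0) (n : ℕ) :
    ∑ y : Fin n → α, (∏ l, p (y l)) * (∑ l, f (y l)) ^ 2 = n * ∑ a, p a * f a ^ 2 := by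
  induction n with
  | zero => simp
  | succ n ih =>
    rw [sum_fin_succ_arrow]
    simp only [Fin.prod_univ_succ, Fin.sum_univ_succ, Fin.cons_zero, Fin.cons_succ]
    have h : ∀ a, ∑ y : Fin n → α, (p a * ∏ l, p (y l)) * (f a + ∑ l, f (y l)) ^ 2
        = p a * f a ^ 2 + p a * (n * ∑ a, p a * f a ^ 2) := fun a => by
      calc _ = p a * f a ^ 2 * (∑ y : Fin n → α, ∏ l, p (y l))
            + 2 * p a * f a * (∑ y : Fin n → α, (∏ l, p (y l)) * ∑ l, f (y l))
            + p a * ∑ y : Fin n → α, (∏ l, p (y l)) * (∑ l, f (y l)) ^ 2 := by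
            rw [Finset.mul_sum, Finset.mul_sum, Finset.mul_sum, ← Finset.sum_add_distrib,
              ← Finset.sum_add_distrib]
            exact Finset.sum_congr rfl fun y _ => by ring
        _ = _ := by rw [ih, sum_prod_eq_one hp, sum_prod_mul_sum_eq_zero hp hf]; ring
    simp only [h]
    rw [Finset.sum_add_distrib, ← Finset.sum_mul, hp.2]
    push_cast
    ring

lemma exists_sum_deviation_le {p : α → ℝ} (hp : IsPMF p) {ε : ℝ} (hε : 0 < ε) (a : α) :
    ∃ C : ℝ, ∀ n : ℕ, 0 < n →
      ∑ y ∈ Finset.univ.filter (fun y : Fin n → α => ε * p a < |empirical y a - p a|),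
        ∏ l, p (y l) ≤ C / n := by
  rcases (hp.1 a).eq_or_lt with ha | ha
  · refine ⟨0, fun n hn => ?_⟩
    rw [zero_div]
    refine (Finset.sum_eq_zero fun y hy => ?_).le
    rw [Finset.mem_filter, ← ha, mul_zero, sub_zero] at hy
    have hne : (Finset.univ.filter (fun l => y l = a)).Nonempty := by
      rw [Finset.nonempty_iff_ne_empty]
      intro h
      simp [empirical, h] at hy
    obtain ⟨l, hl⟩ := hne
    exact Finset.prod_eq_zero (Finset.mem_univ l) (by rw [(Finset.mem_filter.1 hl).2, ← ha])
  · set f : α → ℝ := fun b => (if b = a then 1 else 0) - p a with hf_def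
    have hf : ∑ b, p b * f b = 0 := by
      simp [hf_def, mul_sub, Finset.sum_sub_distrib, ← Finset.sum_mul, hp.2]
    refine ⟨(∑ b, p b * f b ^ 2) / (ε * p a) ^ 2, fun n hn => ?_⟩
    have hn' : (0 : ℝ) < n := by exact_mod_cast hn
    have hsum : ∀ y : Fin n → α, ∑ l, f (y l) = n * (empirical y a - p a) := fun y => by
      rw [← mul_sum_empirical_mul hn]
      simp [hf_def, mul_sub, Finset.sum_sub_distrib, ← Finset.sum_mul, (isPMF_empirical hn y).2]
    have hnn : ∀ y : Fin n → α, 0 ≤ ∏ l, p (y l) := fun y =>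
      Finset.prod_nonneg fun l _ => hp.1 _
    have hmain : (∑ y ∈ Finset.univ.filter
        (fun y : Fin n → α => ε * p a < |empirical y a - p a|), ∏ l, p (y l))
          * (n * (ε * p a)) ^ 2 ≤ n * ∑ b, p b * f b ^ 2 := by
      rw [← sum_prod_mul_sum_sq hp hf n, Finset.sum_mul]
      refine (Finset.sum_le_sum fun y hy => ?_).trans
        (Finset.sum_le_sum_of_subset_of_nonneg (Finset.filter_subset _ _)
          fun y _ _ => mul_nonneg (hnn y) (sq_nonneg _))
      refine mul_le_mul_of_nonneg_left ?_ (hnn y)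
      rw [hsum, mul_pow, mul_pow (n : ℝ), ← sq_abs (empirical y a - p a)]
      have hy' := (Finset.mem_filter.1 hy).2
      gcongr
    rw [div_div, le_div_iff₀ (by positivity)]
    refine le_of_mul_le_mul_left ?_ hn'
    calc _ = _ := by ring
      _ ≤ _ := hmain

lemma exists_half_le_sum_typical {p : α → ℝ} (hp : IsPMF p) {ε : ℝ} (hε : 0 < ε) :
    ∃ n₀ : ℕ, ∀ n ≥ n₀, 1 / 2 ≤
      ∑ y ∈ Finset.univ.filter (fun y : Fin n → α => Typical n ε p y), ∏ l, p (y l) := by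
  choose C hC using exists_sum_deviation_le hp hε
  obtain ⟨n₀, hn₀⟩ := exists_nat_ge (2 * ∑ a, C a)
  refine ⟨n₀ + 1, fun n hn => ?_⟩
  have hn' : 0 < n := by omega
  have hnR : (0 : ℝ) < n := by exact_mod_cast hn'
  have hnn : ∀ y : Fin n → α, 0 ≤ ∏ l, p (y l) := fun y =>
    Finset.prod_nonneg fun l _ => hp.1 _
  have hsplit := Finset.sum_filter_add_sum_filter_not Finset.univ
    (fun y : Fin n → α => Typical n ε p y) (fun y => ∏ l, p (y l))
  rw [sum_prod_eq_one hp] at hsplit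
  have hbad : ∑ y ∈ Finset.univ.filter (fun y : Fin n → α => ¬ Typical n ε p y), ∏ l, p (y l)
      ≤ ∑ a, ∑ y ∈ Finset.univ.filter
        (fun y : Fin n → α => ε * p a < |empirical y a - p a|), ∏ l, p (y l) := by
    simp only [Finset.sum_filter]
    rw [Finset.sum_comm]
    refine Finset.sum_le_sum fun y _ => ?_
    have hterm : ∀ a ∈ Finset.univ, 0 ≤ if ε * p a < |empirical y a - p a| then
        ∏ l, p (y l) else 0 := fun a _ => by
      split_ifs
      exacts [hnn y, le_rfl]
    split_ifs with hy
    · exact Finset.sum_nonneg hterm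
    · unfold Typical at hy
      push Not at hy
      obtain ⟨a, ha⟩ := hy
      refine le_trans ?_ (Finset.single_le_sum hterm (Finset.mem_univ a))
      exact (if_pos ha).ge
  have hle : ∑ a, C a / n ≤ 1 / 2 := by
    rw [← Finset.sum_div, div_le_iff₀ hnR]
    have : (n₀ : ℝ) ≤ n := by exact_mod_cast (by omega : n₀ ≤ n)
    linarith
  have := hbad.trans (Finset.sum_le_sum fun a _ => hC a n hn')
  linarith

end LawOfLargeNumbers

section MarginalTypicality

variable {α ι : Type*} [Fintype α] {β : ι → Type*}

/-- PMFs whose pushforwards along each `f j` lie within relative error `ε` of `Q j`. -/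
def nearFeasible (f : ∀ j, α → β j) (Q : ∀ j, β j → ℝ) (ε : ℝ) : Set (α → ℝ) :=
  {π | IsPMF π ∧ ∀ j b, |push (f j) π b - Q j b| ≤ ε * Q j b}

lemma exists_ent_le_of_nearFeasible {f : ∀ j, α → β j} {Q : ∀ j, β j → ℝ} {h : ℝ}
    (hmax : ∀ π, IsPMF π → (∀ j, push (f j) π = Q j) → Ent π ≤ h) {η : ℝ} (hη : 0 < η) :
    ∃ ε > 0, ∀ π ∈ nearFeasible f Q ε, Ent π ≤ h + η := by
  by_contra! hcon
  choose π hπ hent using fun k : ℕ => hcon (1 / ((k : ℝ) + 1)) Nat.one_div_pos_of_nat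
  obtain ⟨π', hπ', φ, hφ, hlim⟩ := isCompact_setOf_isPMF.tendsto_subseq fun k => (hπ k).1
  have hfeas : ∀ j, push (f j) π' = Q j := by
    intro j
    funext b
    have h1 := (((continuous_push (f j) b).tendsto π').comp hlim).sub_const (Q j b)
    have h2 : Filter.Tendsto (fun k => 1 / ((φ k : ℝ) + 1) * Q j b) Filter.atTop (nhds 0) := by
      simpa using ((tendsto_one_div_add_atTop_nhds_zero_nat (𝕜 := ℝ)).comp
        hφ.tendsto_atTop).mul_const (Q j b)
    have h3 := le_of_tendsto_of_tendsto' h1.abs h2 fun k => (hπ (φ k)).2 j b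
    exact sub_eq_zero.1 (abs_nonpos_iff.1 h3)
  have h4 := ge_of_tendsto' ((continuous_ent.tendsto π').comp hlim) fun k => (hent (φ k)).le
  linarith [hmax π' hπ' hfeas]

lemma exists_entropy_modulus {f : ∀ j, α → β j} {Q : ∀ j, β j → ℝ} (hQ : ∀ j b, 0 ≤ Q j b)
    {h : ℝ} (hmax : ∀ π, IsPMF π → (∀ j, push (f j) π = Q j) → Ent π ≤ h) :
    ∃ δ : ℝ → ℝ, (∀ ε, 0 ≤ δ ε) ∧
      Filter.Tendsto δ (nhdsWithin 0 (Set.Ioi 0)) (nhds 0) ∧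
      ∀ ε, ∀ π ∈ nearFeasible f Q ε, Ent π ≤ h + δ ε := by
  have hbdd : ∀ ε, BddAbove (insert h (Ent '' nearFeasible f Q ε)) := fun ε =>
    (bddAbove_ent.mono (Set.image_mono fun π hπ => hπ.1)).insert h
  refine ⟨fun ε => sSup (insert h (Ent '' nearFeasible f Q ε)) - h,
    fun ε => sub_nonneg.2 (le_csSup (hbdd ε) (Set.mem_insert _ _)), ?_,
    fun ε π hπ => ?_⟩
  · rw [Metric.tendsto_nhds]
    intro η hη
    obtain ⟨ε₁, hε₁, hle⟩ := exists_ent_le_of_nearFeasible hmax (half_pos hη)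
    filter_upwards [Ioo_mem_nhdsGT hε₁] with ε hε
    rw [Real.dist_eq, sub_zero,
      abs_of_nonneg (sub_nonneg.2 (le_csSup (hbdd ε) (Set.mem_insert _ _)))]
    have : sSup (insert h (Ent '' nearFeasible f Q ε)) ≤ h + η / 2 := by
      refine csSup_le (Set.insert_nonempty _ _) ?_
      rintro _ (rfl | ⟨π, hπ, rfl⟩)
      · linarith
      · exact hle π ⟨hπ.1, fun j b => (hπ.2 j b).trans
          (mul_le_mul_of_nonneg_right hε.2.le (hQ j b))⟩
    linarith
  · have := le_csSup (hbdd ε) (Set.mem_insert_of_mem h (Set.mem_image_of_mem Ent hπ))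
    linarith

lemma card_marginal_typical_le [∀ j, Fintype (β j)]
    {f : ∀ j, α → β j} {Q : ∀ j, β j → ℝ} {ε h : ℝ} {n : ℕ}
    (hn : 0 < n) (hle : ∀ π ∈ nearFeasible f Q ε, Ent π ≤ h) :
    ((Finset.univ.filter
        (fun y : Fin n → α => ∀ j, Typical n ε (Q j) (fun l => f j (y l)))).card : ℝ)
      ≤ ((n : ℝ) + 1) ^ Fintype.card α * 2 ^ ((n : ℝ) * h) := by
  refine card_le_of_ent_empirical_le hn _ fun y hy => hle _ ⟨isPMF_empirical hn y, fun j b => ?_⟩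
  rw [push_empirical]
  exact (Finset.mem_filter.1 hy).2 j b

lemma le_card_marginal_typical [∀ j, Fintype (β j)]
    {f : ∀ j, α → β j} {p : α → ℝ} (hp : IsPMF p) {ε : ℝ} {n : ℕ}
    (hn : 0 < n)
    (hhalf : 1 / 2 ≤
      ∑ y ∈ Finset.univ.filter (fun y : Fin n → α => Typical n ε p y), ∏ l, p (y l)) :
    (2 : ℝ) ^ ((n : ℝ) * (Ent p - ε * ∑ a, p a * |Real.logb 2 (p a)|) - 1) ≤
      ((Finset.univ.filter (fun y : Fin n → α =>
        ∀ j, Typical n ε (push (f j) p) (fun l => f j (y l)))).card : ℝ) := by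
  set K := Ent p - ε * ∑ a, p a * |Real.logb 2 (p a)| with hK
  set B := Finset.univ.filter (fun y : Fin n → α => Typical n ε p y)
  have hmass : ∀ y ∈ B, ∏ l, p (y l) ≤ (2 : ℝ) ^ (-((n : ℝ) * K)) := by
    intro y hy
    have hy' := (Finset.mem_filter.1 hy).2
    rw [prod_eq_two_rpow hn y p (fun a => Real.logb 2 (p a)) fun l =>
      (Real.rpow_logb two_pos (by norm_num) (hy'.apply_pos hp.1 hn l)).symm]
    refine Real.rpow_le_rpow_of_exponent_le one_le_two ?_
    rw [← mul_neg]
    refine mul_le_mul_of_nonneg_left ?_ n.cast_nonneg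
    have := (abs_le.1 (hy'.abs_sum_sub_le fun a => Real.logb 2 (p a))).2
    rw [hK, Ent]
    linarith
  have hcard : (B.card : ℝ) ≤ ((Finset.univ.filter (fun y : Fin n → α =>
      ∀ j, Typical n ε (push (f j) p) (fun l => f j (y l)))).card : ℝ) := by
    refine Nat.cast_le.2 (Finset.card_le_card fun y hy => ?_)
    exact Finset.mem_filter.2
      ⟨Finset.mem_univ _, fun j => (Finset.mem_filter.1 hy).2.push (f j)⟩
  refine le_trans ?_ hcard
  have h := hhalf.trans (Finset.sum_le_sum hmass)
  rw [Finset.sum_const, nsmul_eq_mul, Real.rpow_neg two_pos.le, ← div_eq_mul_inv,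
    le_div_iff₀ (by positivity)] at h
  rw [Real.rpow_sub two_pos, Real.rpow_one]
  linarith

/-- If on marginally typical sequences the weight of a sequence is `2 ^ (-n D)` up to an exponent
error `n ε C`, then the total weight of these sequences is governed by `D` minus the entropy of
the entropy maximizer. -/
theorem exists_sum_weight_marginal_typical_bounds [∀ j, Fintype (β j)]
    {f : ∀ j, α → β j} {p : α → ℝ} (hp : IsPMF p)
    (hmax : ∀ π, IsPMF π → (∀ j, push (f j) π = push (f j) p) → Ent π ≤ Ent p)
    {w : ∀ n, (Fin n → α) → ℝ} {D C : ℝ} (hC : 0 ≤ C)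
    (hw : ∀ ε > 0, ∀ n > 0, ∀ y : Fin n → α,
      (∀ j, Typical n ε (push (f j) p) (fun l => f j (y l))) →
        (2 : ℝ) ^ ((n : ℝ) * (-D - ε * C)) ≤ w n y ∧ w n y ≤ 2 ^ ((n : ℝ) * (-D + ε * C))) :
    ∃ δ : ℝ → ℝ, DeltaFun δ ∧ ∀ ε > 0, ∃ n₀ : ℕ, ∀ n ≥ n₀,
      (2 : ℝ) ^ (-(n : ℝ) * (D - Ent p + δ ε)) ≤
        (∑ y ∈ Finset.univ.filter (fun y : Fin n → α =>
          ∀ j, Typical n ε (push (f j) p) (fun l => f j (y l))), w n y) ∧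
      (∑ y ∈ Finset.univ.filter (fun y : Fin n → α =>
          ∀ j, Typical n ε (push (f j) p) (fun l => f j (y l))), w n y) ≤
        (2 : ℝ) ^ (-(n : ℝ) * (D - Ent p - δ ε)) := by
  obtain ⟨δ₀, hδ₀, hlim, hent⟩ := exists_entropy_modulus (Q := fun j => push (f j) p)
    (fun j => (hp.push (f j)).1) hmax
  set L := ∑ a, p a * |Real.logb 2 (p a)| with hL_def
  have hL : 0 ≤ L := Finset.sum_nonneg fun a _ => mul_nonneg (hp.1 a) (abs_nonneg _)
  refine ⟨fun ε => ε * (C + L + 1) + δ₀ ε, ⟨fun ε hε => ?_, ?_⟩, fun ε hε => ?_⟩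
  · have := hδ₀ ε
    positivity
  · have h1 : Filter.Tendsto (fun ε : ℝ => ε * (C + L + 1)) (nhdsWithin 0 (Set.Ioi 0))
        (nhds (0 * (C + L + 1))) :=
      (Filter.tendsto_id.mono_left nhdsWithin_le_nhds).mul_const _
    simpa using h1.add hlim
  obtain ⟨n₁, hn₁⟩ := exists_forall_pow_le_two_rpow (Fintype.card α) hε
  obtain ⟨n₂, hn₂⟩ := exists_half_le_sum_typical hp hε
  obtain ⟨n₃, hn₃⟩ := exists_nat_ge (1 / ε)
  refine ⟨n₁ + n₂ + n₃ + 1, fun n hn => ?_⟩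
  have hn0 : 0 < n := by omega
  have hnε : 1 ≤ (n : ℝ) * ε := by
    rw [← div_le_iff₀ hε]
    exact hn₃.trans (by exact_mod_cast (by omega : n₃ ≤ n))
  have hlow := le_card_marginal_typical (f := f) hp hn0 (hn₂ n (by omega))
  have hupp := card_marginal_typical_le hn0 (hent ε)
  set T := Finset.univ.filter (fun y : Fin n → α =>
    ∀ j, Typical n ε (push (f j) p) (fun l => f j (y l))) with hT
  have hwT : ∀ y ∈ T, _ := fun y hy => hw ε hε n hn0 y (Finset.mem_filter.1 hy).2
  have hnδ : 0 ≤ (n : ℝ) * δ₀ ε := mul_nonneg n.cast_nonneg (hδ₀ ε)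
  have hnL : 0 ≤ (n : ℝ) * (ε * L) := by positivity
  constructor
  · have hsum := Finset.card_nsmul_le_sum T (w n) _ fun y hy => (hwT y hy).1
    rw [nsmul_eq_mul] at hsum
    refine le_trans ?_ hsum
    refine le_trans ?_ (mul_le_mul_of_nonneg_right hlow (by positivity))
    rw [← Real.rpow_add two_pos]
    refine Real.rpow_le_rpow_of_exponent_le one_le_two ?_
    rw [← hL_def]
    linarith
  · have hsum := Finset.sum_le_card_nsmul T (w n) _ fun y hy => (hwT y hy).2
    rw [nsmul_eq_mul] at hsum
    refine hsum.trans ?_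
    refine (mul_le_mul_of_nonneg_right (hupp.trans (mul_le_mul_of_nonneg_right
      (hn₁ n (by omega)) (by positivity))) (by positivity)).trans ?_
    rw [← Real.rpow_add two_pos, ← Real.rpow_add two_pos]
    refine Real.rpow_le_rpow_of_exponent_le one_le_two ?_
    linarith

end MarginalTypicality

section PrescribedMarginals

variable {N M : ℕ} {X : Fin N → Type} [∀ i, Fintype (X i)]

lemma ent_le_Hstar_univ {S : Fin M → Finset (Fin N)} {PS : ∀ j, Vec X (S j) → ℝ}
    {q : (∀ i, X i) → ℝ} (hq : IsPMF q) (hqS : ∀ j, margF q (S j) = PS j) :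
    Ent q ≤ Hstar S PS Finset.univ := by
  let e : (∀ i, X i) ≃ Vec X Finset.univ :=
    { toFun := fun x i => x i.1
      invFun := fun v i => v ⟨i, Finset.mem_univ i⟩
      left_inv := fun _ => rfl
      right_inv := fun _ => rfl }
  rw [← ent_push_equiv e q]
  refine le_csSup ((bddAbove_ent (α := Vec X Finset.univ)).mono ?_)
    ⟨push e q, hq.push e, fun j => ?_, rfl⟩
  · rintro _ ⟨π, hπ, -, rfl⟩
    exact Set.mem_image_of_mem Ent hπ
  · rw [← hqS j, margF, marg, marg, push_push, push_push]
    rfl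

/-- Difference of the binary logarithms of two marginals of `Q`. -/
noncomputable def logCond {T B B' : Finset (Fin N)} (Q : Vec X T → ℝ) (h : B ⊆ T) (h' : B' ⊆ T)
    (v : Vec X T) : ℝ :=
  Real.logb 2 (marg Q h (restr h v)) - Real.logb 2 (marg Q h' (restr h' v))

lemma sum_mul_logCond {T B B' : Finset (Fin N)} (Q : Vec X T → ℝ) (h : B ⊆ T) (h' : B' ⊆ T) :
    ∑ v, Q v * logCond Q h h' v = -(Ent (marg Q h) - Ent (marg Q h')) := by
  have key : ∀ {B : Finset (Fin N)} (h : B ⊆ T),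
      ∑ v, Q v * Real.logb 2 (marg Q h (restr h v)) = -Ent (marg Q h) := fun h => by
    rw [Ent, neg_neg]
    exact (sum_push_mul (restr h) Q fun b => Real.logb 2 (marg Q h b)).symm
  simp only [logCond, mul_sub, Finset.sum_sub_distrib, key]
  ring

lemma two_rpow_logCond {T B B' : Finset (Fin N)} {Q : Vec X T → ℝ} (hQ : ∀ v, 0 ≤ Q v)
    (h : B ⊆ T) (h' : B' ⊆ T) {v : Vec X T} (hv : 0 < Q v) :
    (2 : ℝ) ^ logCond Q h h' v = marg Q h (restr h v) / marg Q h' (restr h' v) := by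
  have hpos : ∀ {B : Finset (Fin N)} (h : B ⊆ T), 0 < marg Q h (restr h v) := fun h =>
    hv.trans_le (le_push hQ v)
  rw [logCond, Real.rpow_sub two_pos, Real.rpow_logb two_pos (by norm_num) (hpos h),
    Real.rpow_logb two_pos (by norm_num) (hpos h')]

lemma condMass_bounds {S : Fin M → Finset (Fin N)} {PS : ∀ j, Vec X (S j) → ℝ}
    (hPS : ∀ j v, 0 ≤ PS j v) (A : Fin N → Finset (Fin N)) (jsel : Fin N → Fin M)
    (hjsel : ∀ i, insert i (A i) ⊆ S (jsel i)) {ε : ℝ} {n : ℕ} (hn : 0 < n)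
    (y : Fin n → ∀ i, X i)
    (hy : ∀ j, Typical n ε (PS j) (fun l (i : {i // i ∈ S j}) => y l i.1)) :
    let D := ∑ i, (Ent (marg (PS (jsel i)) (hjsel i)) -
      Ent (marg (PS (jsel i)) ((Finset.subset_insert i (A i)).trans (hjsel i))))
    let C := ∑ i, ∑ v, PS (jsel i) v *
      |logCond (PS (jsel i)) (hjsel i) ((Finset.subset_insert i (A i)).trans (hjsel i)) v|
    (2 : ℝ) ^ ((n : ℝ) * (-D - ε * C)) ≤ condMass S PS A jsel hjsel n (fun i l => y l i) ∧
      condMass S PS A jsel hjsel n (fun i l => y l i) ≤ 2 ^ ((n : ℝ) * (-D + ε * C)) := by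
  intro D C
  set g : ∀ i, Vec X (S (jsel i)) → ℝ := fun i =>
    logCond (PS (jsel i)) (hjsel i) ((Finset.subset_insert i (A i)).trans (hjsel i)) with hg
  set z : ∀ i, Fin n → Vec X (S (jsel i)) := fun i l k => y l k.1 with hz
  have hmass : condMass S PS A jsel hjsel n (fun i l => y l i) =
      (2 : ℝ) ^ ((n : ℝ) * ∑ i, ∑ v, empirical (z i) v * g i v) := by
    rw [Finset.mul_sum, Real.rpow_sum_of_pos two_pos, condMass]
    refine Finset.prod_congr rfl fun i _ => ?_
    rw [mul_sum_empirical_mul hn, Real.rpow_sum_of_pos two_pos]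
    exact Finset.prod_congr rfl fun l _ => (two_rpow_logCond (hPS _) _ _
      ((hy (jsel i)).apply_pos (hPS _) hn l)).symm
  have hdev : |∑ i, ∑ v, empirical (z i) v * g i v - -D| ≤ ε * C := by
    have hD : -D = ∑ i, ∑ v, PS (jsel i) v * g i v := by
      simp only [hg, sum_mul_logCond, Finset.sum_neg_distrib, D]
    rw [hD, ← Finset.sum_sub_distrib, Finset.mul_sum]
    exact (Finset.abs_sum_le_sum_abs _ _).trans
      (Finset.sum_le_sum fun i _ => (hy (jsel i)).abs_sum_sub_le (g i))
  rw [hmass]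
  obtain ⟨h1, h2⟩ := abs_le.1 hdev
  exact ⟨Real.rpow_le_rpow_of_exponent_le one_le_two
      (mul_le_mul_of_nonneg_left (by linarith) n.cast_nonneg),
    Real.rpow_le_rpow_of_exponent_le one_le_two
      (mul_le_mul_of_nonneg_left (by linarith) n.cast_nonneg)⟩

end PrescribedMarginals

theorem conditional_subset_typicality_lemma
    {N M : ℕ} (hN : 0 < N) (hM : 0 < M)
    {X : Fin N → Type} [∀ i, Fintype (X i)] [∀ i, Nonempty (X i)]
    (P : ∀ i, X i → ℝ) (S : Fin M → Finset (Fin N)) (PS : ∀ j, Vec X (S j) → ℝ)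
    (hcons : Consistent P S PS)
    (hexist : ∃ p : (∀ i, X i) → ℝ, IsPMF p ∧ ∀ j, margF p (S j) = PS j)
    (A : Fin N → Finset (Fin N)) (hA : ∀ i, A i ⊆ Finset.Iio i)
    (jsel : Fin N → Fin M) (hjsel : ∀ i, insert i (A i) ⊆ S (jsel i))
    (Pstar : (∀ i, X i) → ℝ) (hPstar : IsPMF Pstar)
    (hPstarMarg : ∀ j, margF Pstar (S j) = PS j)
    (hPstarMax : Ent Pstar = Hstar S PS Finset.univ) :
    ∃ δ : ℝ → ℝ, DeltaFun δ ∧ ∃ ε₀ > 0, ∀ ε, 0 < ε → ε ≤ ε₀ →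
      ∃ n₀ : ℕ, ∀ n ≥ n₀,
        (2 : ℝ) ^ (-(n : ℝ) * ((∑ i, (Ent (marg (PS (jsel i)) (hjsel i)) -
              Ent (marg (PS (jsel i)) ((Finset.subset_insert i (A i)).trans (hjsel i))))) -
            Ent Pstar + δ ε))
          ≤ (∑ x ∈ Finset.univ.filter (fun x : ∀ i, Fin n → X i => ∀ j, SubTyp n ε (PS j) x),
              condMass S PS A jsel hjsel n x) ∧
        (∑ x ∈ Finset.univ.filter (fun x : ∀ i, Fin n → X i => ∀ j, SubTyp n ε (PS j) x),
              condMass S PS A jsel hjsel n x)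
          ≤ (2 : ℝ) ^ (-(n : ℝ) * ((∑ i, (Ent (marg (PS (jsel i)) (hjsel i)) -
              Ent (marg (PS (jsel i)) ((Finset.subset_insert i (A i)).trans (hjsel i))))) -
            Ent Pstar - δ ε)) := by
  have hmarg : ∀ j, push (fun (x : ∀ i, X i) (i : {i // i ∈ S j}) => x i.1) Pstar = PS j :=
    hPstarMarg
  have hPS : ∀ j v, 0 ≤ PS j v := fun j => (hcons.2.1 j).1
  obtain ⟨δ, hδ, hbounds⟩ := exists_sum_weight_marginal_typical_bounds
    (f := fun j (x : ∀ i, X i) (i : {i // i ∈ S j}) => x i.1) hPstar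
    (fun π hπ hπS => hPstarMax ▸ ent_le_Hstar_univ hπ fun j => (hπS j).trans (hmarg j))
    (w := fun n y => condMass S PS A jsel hjsel n (fun i l => y l i))
    (D := ∑ i, (Ent (marg (PS (jsel i)) (hjsel i)) -
      Ent (marg (PS (jsel i)) ((Finset.subset_insert i (A i)).trans (hjsel i)))))
    (C := ∑ i, ∑ v, PS (jsel i) v *
      |logCond (PS (jsel i)) (hjsel i) ((Finset.subset_insert i (A i)).trans (hjsel i)) v|)
    (Finset.sum_nonneg fun i _ => Finset.sum_nonneg fun v _ =>
      mul_nonneg (hPS _ v) (abs_nonneg _))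
    (fun ε _ n hn y hy => condMass_bounds hPS A jsel hjsel hn y fun j => hmarg j ▸ hy j)
  refine ⟨δ, hδ, 1, one_pos, fun ε hε _ => ?_⟩
  obtain ⟨n₀, hn₀⟩ := hbounds ε hε
  refine ⟨n₀, fun n hn => ?_⟩
  have h := hn₀ n hn
  simp only [hmarg] at h
  have hsum : ∑ x ∈ Finset.univ.filter (fun x : ∀ i, Fin n → X i => ∀ j, SubTyp n ε (PS j) x),
      condMass S PS A jsel hjsel n x =
      ∑ y ∈ Finset.univ.filter (fun y : Fin n → ∀ i, X i =>
        ∀ j, Typical n ε (PS j) (fun l (i : {i // i ∈ S j}) => y l i.1)),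
        condMass S PS A jsel hjsel n (fun i l => y l i) :=
    Finset.sum_equiv (Equiv.piComm fun i _ => X i)
      (fun x => by simp only [Finset.mem_filter, Finset.mem_univ, true_and]; rfl) fun x _ => rfl
  rw [hsum]
  exact h
end

section
/- In the example instance, the rate tuple (0, 0, 0, 3 + H_b(1/4) − H*({1,2,3,4})) belongs to ℛ_a*; that is, it satisfies ∑_{i∈𝒥} R_i ≥ ∑_{i∈𝒥} H(P_i) − H*(𝒥) for every nonempty 𝒥 ⊆ {1,2,3,4}. -/
open scoped Classical

noncomputable section

/-- The rate region `ℛ_a`: the closed convex hull of rate tuples achievable with a single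
joint distribution consistent with all the prescribed subset distributions. -/
def Ra {N M : ℕ} {X : Fin N → Type} [∀ i, Fintype (X i)] (P : ∀ i, X i → ℝ)
    (S : Fin M → Finset (Fin N)) (PS : ∀ j, Vec X (S j) → ℝ) : Set (Fin N → ℝ) :=
  closure (convexHull ℝ
    { R | ∃ p : (∀ i, X i) → ℝ, IsPMF p ∧ (∀ j, margF p (S j) = PS j) ∧
        ∀ J : Finset (Fin N), J.Nonempty →
          ∑ i ∈ J, R i ≥ (∑ i ∈ J, Ent (P i)) - Ent (margF p J) })

/-- The rate region `ℛ_a*` given by the constrained maximum entropy functionals. -/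
def RaStar {N M : ℕ} {X : Fin N → Type} [∀ i, Fintype (X i)] (P : ∀ i, X i → ℝ)
    (S : Fin M → Finset (Fin N)) (PS : ∀ j, Vec X (S j) → ℝ) : Set (Fin N → ℝ) :=
  { R | ∀ J : Finset (Fin N), J.Nonempty →
      ∑ i ∈ J, R i ≥ (∑ i ∈ J, Ent (P i)) - Hstar S PS J }

end
noncomputable section

/-- The six two-element constraint subsets of the example instance
(coordinates `0,1,2,3` standing for `X₁,X₂,X₃,X₄`). -/
def Spairs : Fin 6 → Finset (Fin 4) := ![{0, 1}, {0, 2}, {1, 2}, {0, 3}, {1, 3}, {2, 3}]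

/-- The marginal PMFs of the example: `X₁,X₂,X₃ ~ bern(1/2)`, `X₄ ~ bern(3/4)`
(with `false` standing for `0`). -/
def Pex : ∀ _ : Fin 4, Bool → ℝ :=
  fun i b => if i.1 < 3 then 1 / 2 else if b = false then 3 / 4 else 1 / 4

/-- The prescribed pairwise PMF of `(Xᵢ, X₄)`: mass `1/2` at `(0,0)`, `0` at `(0,1)`,
`1/4` at `(1,0)` and `1/4` at `(1,1)`. -/
def pair14 : Bool → Bool → ℝ :=
  fun a b => if a = false then (if b = false then 1 / 2 else 0) else 1 / 4

/-- Value of a tuple `y` on subset `A` at a coordinate `i` (junk value `false` if `i ∉ A`). -/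
def getB {A : Finset (Fin 4)} (y : Vec (fun _ : Fin 4 => Bool) A) (i : Fin 4) : Bool :=
  if h : i ∈ A then y ⟨i, h⟩ else false

/-- The prescribed pairwise distributions of the example instance: `(Xᵢ, Xⱼ)` is uniform on
`{0,1}²` for `i < j` in `{1,2,3}`, and `(Xᵢ, X₄)` is distributed according to `pair14`. -/
def PSex (j : Fin 6) : Vec (fun _ : Fin 4 => Bool) (Spairs j) → ℝ :=
  fun y =>
    if j.1 < 3 then 1 / 4
    else pair14 (getB y ⟨j.1 - 3, by have := j.isLt; omega⟩) (getB y 3)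

/-- Binary entropy function (in bits). -/
def Hb (p : ℝ) : ℝ := -(p * Real.logb 2 p) - (1 - p) * Real.logb 2 (1 - p)

end

lemma push_eq_sum_ite {α β : Type*} [Fintype α] [DecidableEq β] (f : α → β) (p : α → ℝ) (b : β) :
    push f p b = ∑ a, if f a = b then p a else 0 := by
  rw [push, Finset.sum_filter]
  exact Finset.sum_congr rfl fun a _ => by congr

lemma Ent_nonneg {α : Type*} [Fintype α] {p : α → ℝ} (hp : IsPMF p) : 0 ≤ Ent p := by
  have hle (x : α) : p x ≤ 1 :=
    hp.2 ▸ Finset.single_le_sum (fun y _ => hp.1 y) (Finset.mem_univ x)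
  rw [Ent, neg_nonneg]
  exact Finset.sum_nonpos fun x _ => mul_nonpos_of_nonneg_of_nonpos (hp.1 x)
    (Real.logb_nonpos one_lt_two (hp.1 x) (hle x))

lemma neg_one_le_mul_log {x : ℝ} (hx : 0 ≤ x) : -1 ≤ x * Real.log x := by
  rcases hx.eq_or_lt with rfl | hx
  · simp
  · have h := mul_le_mul_of_nonneg_left (Real.one_sub_inv_le_log_of_pos hx) hx.le
    rw [mul_sub, mul_inv_cancel₀ hx.ne'] at h
    linarith

lemma Ent_le {α : Type*} [Fintype α] {p : α → ℝ} (hp : IsPMF p) :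
    Ent p ≤ Fintype.card α / Real.log 2 := by
  have hlog : 0 < Real.log 2 := Real.log_pos one_lt_two
  have h : Ent p = (∑ x, -(p x * Real.log (p x))) / Real.log 2 := by
    simp only [Ent, Real.logb, Finset.sum_div, ← Finset.sum_neg_distrib]
    exact Finset.sum_congr rfl fun x _ => by ring
  rw [h]
  gcongr
  calc ∑ x, -(p x * Real.log (p x)) ≤ ∑ _x : α, (1 : ℝ) :=
        Finset.sum_le_sum fun x _ => by linarith [neg_one_le_mul_log (hp.1 x)]
    _ = Fintype.card α := by simp

/-- A PMF that is uniform on its support, of size `2 ^ n`, has entropy `n`. -/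
lemma Ent_eq_of_flat {α : Type*} [Fintype α] {p : α → ℝ} (hp : ∑ x, p x = 1) (n : ℕ)
    (h : ∀ x, p x = 0 ∨ p x = 1 / 2 ^ n) : Ent p = n := by
  have hx (x : α) : p x * Real.logb 2 (p x) = -n * p x := by
    rcases h x with h | h
    · simp [h]
    · rw [h, one_div, Real.logb_inv, Real.logb_pow, Real.logb_self_eq_one one_lt_two]
      ring
  simp only [Ent, hx, ← Finset.mul_sum, hp]
  ring

section

variable {N M : ℕ} {X : Fin N → Type} [∀ i, Fintype (X i)]

lemma Hstar_nonneg (S : Fin M → Finset (Fin N)) (PS : ∀ j, Vec X (S j) → ℝ)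
    (J : Finset (Fin N)) : 0 ≤ Hstar S PS J :=
  Real.sSup_nonneg fun _ ⟨_, hq, _, h⟩ => h ▸ Ent_nonneg hq

lemma Ent_le_Hstar {S : Fin M → Finset (Fin N)} {PS : ∀ j, Vec X (S j) → ℝ}
    {J : Finset (Fin N)} {q : Vec X J → ℝ} (hq : IsPMF q)
    (hm : ∀ j, marg q (Finset.inter_subset_left : J ∩ S j ⊆ J)
      = marg (PS j) (Finset.inter_subset_right : J ∩ S j ⊆ S j)) :
    Ent q ≤ Hstar S PS J :=
  le_csSup ⟨_, fun _ ⟨_, hq, _, h⟩ => h ▸ Ent_le hq⟩ ⟨q, hq, hm, rfl⟩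

end

/-- The prescribed pairwise distributions of the example, multiplied by `4`. -/
def pairWeight (j : Fin 6) (y : Vec (fun _ : Fin 4 => Bool) (Spairs j)) : ℕ :=
  if j.1 < 3 then 1
  else if getB y ⟨j.1 - 3, by have := j.isLt; omega⟩ = false then
    (if getB y 3 = false then 2 else 0)
  else 1

lemma PSex_eq (j : Fin 6) (y : Vec (fun _ : Fin 4 => Bool) (Spairs j)) :
    PSex j y = pairWeight j y / 4 := by
  unfold PSex pairWeight pair14
  split_ifs <;> norm_num

/-- A family of natural-number weights in `{0, 1}` with total mass `2 ^ n` and the right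
marginals witnesses `n ≤ H*(J)`. -/
lemma le_Hstar_of_weight (J : Finset (Fin 4)) (n : ℕ) (w : Vec (fun _ : Fin 4 => Bool) J → ℕ)
    (hw : ∀ y, w y = 0 ∨ w y = 1) (hsum : ∑ y, w y = 2 ^ n)
    (hm : ∀ j, ∀ z : Vec (fun _ : Fin 4 => Bool) (J ∩ Spairs j),
      4 * (∑ y, if restr Finset.inter_subset_left y = z then w y else 0)
        = 2 ^ n * ∑ y, if restr Finset.inter_subset_right y = z then pairWeight j y else 0) :
    (n : ℝ) ≤ Hstar Spairs PSex J := by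
  have hpos : (0 : ℝ) < 2 ^ n := by positivity
  have hq : IsPMF fun y => (w y : ℝ) / 2 ^ n := by
    refine ⟨fun y => by positivity, ?_⟩
    rw [← Finset.sum_div, div_eq_one_iff_eq hpos.ne']
    exact_mod_cast hsum
  rw [← Ent_eq_of_flat hq.2 n fun y => by rcases hw y with h | h <;> simp [h]]
  refine Ent_le_Hstar hq fun j => funext fun z => ?_
  have h := congrArg (Nat.cast : ℕ → ℝ) (hm j z)
  push_cast at h
  have hl : marg (fun y => (w y : ℝ) / 2 ^ n) (Finset.inter_subset_left : J ∩ Spairs j ⊆ J) z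
      = (∑ y, if restr Finset.inter_subset_left y = z then (w y : ℝ) else 0) / 2 ^ n := by
    rw [marg, push_eq_sum_ite, Finset.sum_div]
    exact Finset.sum_congr rfl fun y _ => by split_ifs <;> simp
  have hr : marg (PSex j) (Finset.inter_subset_right : J ∩ Spairs j ⊆ Spairs j) z
      = (∑ y, if restr Finset.inter_subset_right y = z then (pairWeight j y : ℝ) else 0) / 4 := by
    rw [marg, push_eq_sum_ite, Finset.sum_div]
    exact Finset.sum_congr rfl fun y _ => by split_ifs <;> simp [PSex_eq]
  rw [hl, hr, div_eq_div_iff hpos.ne' four_ne_zero]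
  linarith

lemma card_le_Hstar {J : Finset (Fin 4)} (hJ : 3 ∉ J) : (J.card : ℝ) ≤ Hstar Spairs PSex J := by
  refine le_Hstar_of_weight J J.card (fun _ => 1) (fun _ => Or.inr rfl) (by simp) ?_
  revert J
  decide +kernel

/-- The indicator of the projection to `J` of the support of the only joint distribution with
the prescribed pairwise marginals: `(1,1,1,1)`, `(1,0,0,0)`, `(0,1,0,0)`, `(0,0,1,0)`. -/
def supportWeight (J : Finset (Fin 4)) (y : Vec (fun _ : Fin 4 => Bool) J) : ℕ :=
  if (∀ i, y i = true) ∨ ∃ k : Fin 4, k ≠ 3 ∧ ∀ i, y i = decide (i.1 = k) then 1 else 0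

lemma two_le_Hstar {J : Finset (Fin 4)} (hJ : 3 ∈ J) (hcard : 3 ≤ J.card) :
    2 ≤ Hstar Spairs PSex J := by
  refine mod_cast le_Hstar_of_weight J 2 (supportWeight J)
    (fun y => by unfold supportWeight; split_ifs <;> simp) ?_ ?_
  · revert J
    decide +kernel
  · revert J
    decide +kernel

/-- Four bits as a tuple on all the coordinates. -/
def bits : Bool × Bool × Bool × Bool ≃ Vec (fun _ : Fin 4 => Bool) Finset.univ where
  toFun b := fun i => ![b.1, b.2.1, b.2.2.1, b.2.2.2] i.1
  invFun y := (y ⟨0, Finset.mem_univ _⟩, y ⟨1, Finset.mem_univ _⟩, y ⟨2, Finset.mem_univ _⟩,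
    y ⟨3, Finset.mem_univ _⟩)
  left_inv _ := rfl
  right_inv y := by
    funext ⟨i, hi⟩
    fin_cases i <;> rfl

lemma pairWeight_bits (j : Fin 6) (b : Bool × Bool × Bool × Bool) :
    pairWeight j (restr (Finset.subset_univ _) (bits b))
      = if j.1 < 3 then 1
        else if ![b.1, b.2.1, b.2.2.1] ⟨j.1 - 3, by omega⟩ = false then
          (if b.2.2.2 = false then 2 else 0)
        else 1 := by
  revert j b
  decide

lemma marginal_sum {q : Vec (fun _ : Fin 4 => Bool) Finset.univ → ℝ}
    (hm : ∀ j, marg q (Finset.inter_subset_left : Finset.univ ∩ Spairs j ⊆ Finset.univ)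
      = marg (PSex j) (Finset.inter_subset_right : Finset.univ ∩ Spairs j ⊆ Spairs j))
    (j : Fin 6) (b : Bool × Bool × Bool × Bool) :
    (∑ c : Bool × Bool × Bool × Bool,
      if ∀ i ∈ Spairs j, ![c.1, c.2.1, c.2.2.1, c.2.2.2] i = ![b.1, b.2.1, b.2.2.1, b.2.2.2] i
      then q (bits c) else 0)
      = (if j.1 < 3 then 1
        else if ![b.1, b.2.1, b.2.2.1] ⟨j.1 - 3, by omega⟩ = false then
          (if b.2.2.2 = false then 2 else 0)
        else 1 : ℕ) / 4 := by
  rw [← pairWeight_bits, ← PSex_eq]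
  have h := congrFun (hm j) (restr Finset.inter_subset_left (bits b))
  rw [marg, push_eq_sum_ite, marg, push_eq_sum_ite, ← bits.sum_comp,
    Finset.sum_eq_single (restr (Finset.subset_univ _) (bits b))] at h
  · replace h := h.trans (if_pos rfl)
    rw [← h]
    refine Finset.sum_congr rfl fun c _ => if_congr ?_ rfl rfl
    simp only [funext_iff, restr, Subtype.forall, Finset.mem_inter, Finset.mem_univ, true_and]
    rfl
  · intro y _ hy
    refine if_neg fun hyb => hy (funext fun i => ?_)
    exact congrFun hyb ⟨i.1, Finset.mem_inter.2 ⟨Finset.mem_univ _, i.2⟩⟩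
  · simp

lemma flat_of_marginals {q : Vec (fun _ : Fin 4 => Bool) Finset.univ → ℝ} (hq : IsPMF q)
    (hm : ∀ j, marg q (Finset.inter_subset_left : Finset.univ ∩ Spairs j ⊆ Finset.univ)
      = marg (PSex j) (Finset.inter_subset_right : Finset.univ ∩ Spairs j ⊆ Spairs j))
    (y : Vec (fun _ : Fin 4 => Bool) Finset.univ) : q y = 0 ∨ q y = 1 / 2 ^ 2 := by
  obtain ⟨b, rfl⟩ := bits.surjective y
  have hpos (b) := hq.1 (bits b)
  have h0xx1 := marginal_sum hm 3 (false, true, true, true)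
  have hx0x1 := marginal_sum hm 4 (true, false, true, true)
  have hxx01 := marginal_sum hm 5 (true, true, false, true)
  have h1xx1 := marginal_sum hm 3 (true, true, true, true)
  have h11xx := marginal_sum hm 0 (true, true, true, true)
  have h1x1x := marginal_sum hm 1 (true, true, true, true)
  have hx11x := marginal_sum hm 2 (true, true, true, true)
  have h10xx := marginal_sum hm 0 (true, false, true, true)
  have h01xx := marginal_sum hm 0 (false, true, true, true)
  have h00xx := marginal_sum hm 0 (false, false, true, true)
  have hx01x := marginal_sum hm 2 (true, false, true, true)
  simp [Fintype.sum_prod_type, Spairs]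
    at h0xx1 hx0x1 hxx01 h1xx1 h11xx h1x1x hx11x h10xx h01xx h00xx hx01x
  simp only [Prod.forall, Bool.forall_bool] at hpos
  obtain ⟨⟨⟨⟨_, _⟩, ⟨_, _⟩⟩, ⟨⟨_, _⟩, ⟨_, _⟩⟩⟩, ⟨⟨⟨_, _⟩, ⟨_, _⟩⟩, ⟨⟨_, _⟩, ⟨_, _⟩⟩⟩⟩ := hpos
  obtain ⟨_ | _, _ | _, _ | _, _ | _⟩ := b
  all_goals first | (left; linarith) | (right; linarith)

lemma Hstar_univ_le : Hstar Spairs PSex Finset.univ ≤ 2 := by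
  refine Real.sSup_le ?_ zero_le_two
  rintro _ ⟨q, hq, hm, rfl⟩
  exact mod_cast (Ent_eq_of_flat hq.2 2 (flat_of_marginals hq hm)).le

lemma Ent_Pex (i : Fin 4) : Ent (Pex i) = 1 + if i = 3 then Hb (1 / 4) - 1 else 0 := by
  have h : Real.logb 2 2⁻¹ = -1 := by
    rw [Real.logb_inv, Real.logb_self_eq_one one_lt_two]
  fin_cases i <;> simp [Ent, Pex, Hb, h]
  all_goals norm_num
  ring

theorem corner_point_in_RaStar_example :
    (![0, 0, 0, 3 + Hb (1 / 4) - Hstar Spairs PSex Finset.univ])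
        ∈ RaStar (X := fun _ : Fin 4 => Bool) Pex Spairs PSex := by
  intro J _
  have hR (i : Fin 4) : (![0, 0, 0, 3 + Hb (1 / 4) - Hstar Spairs PSex Finset.univ] : Fin 4 → ℝ) i
      = if i = 3 then 3 + Hb (1 / 4) - Hstar Spairs PSex Finset.univ else 0 := by
    fin_cases i <;> rfl
  simp only [hR, Ent_Pex, Finset.sum_add_distrib, Finset.sum_ite_eq', Finset.sum_const,
    nsmul_eq_mul, mul_one]
  split_ifs with h
  · rcases le_or_gt 3 J.card with hc | hc
    · have hcard : (J.card : ℝ) ≤ 4 := mod_cast J.card_le_univ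
      linarith [two_le_Hstar h hc, Hstar_univ_le]
    · have hcard : (J.card : ℝ) ≤ 2 := mod_cast Nat.le_of_lt_succ hc
      linarith [Hstar_nonneg Spairs PSex J, Hstar_univ_le]
  · linarith [card_le_Hstar h]
end
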